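/- Let a be an integer and let f be a nonnegative decreasing function on [a, ∞) with f(x) → 0 as x → ∞, and let α = lim_{N → ∞} (∑_{n=a}^N f(n) − ∫_a^N f(x) dx). Then for every real ξ ≥ a + 1, one has |∑_{a ≤ n ≤ ξ} f(n) − ∫_a^ξ f(ν) dν − α| ≤ f(ξ − 1). -/

import Mathlib

open Filter Topology

/-- The integral of an antitone function over an interval lies between the products of the length
with its values at the right and left endpoints. -/
lemma AntitoneOn.intervalIntegral_bounds {f : ℝ → ℝ} {x y : ℝ} (hxy : x ≤ y)
    (hf : AntitoneOn f (Set.Icc x y)) :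
    (y - x) * f y ≤ ∫ t in x..y, f t ∧ ∫ t in x..y, f t ≤ (y - x) * f x := by
  have hint : IntervalIntegrable f MeasureTheory.volume x y :=
    AntitoneOn.intervalIntegrable (by rwa [Set.uIcc_of_le hxy])
  constructor
  · have h := intervalIntegral.integral_mono_on hxy intervalIntegrable_const hint
      fun t ht => hf ht (Set.right_mem_Icc.2 hxy) ht.2
    simpa using h
  · have h := intervalIntegral.integral_mono_on hxy hint intervalIntegrable_const
      fun t ht => hf (Set.left_mem_Icc.2 hxy) ht ht.1
    simpa using h

/-- Between two integers `M ≤ N`, the difference of sum and integral of an antitone function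
decreases by at most `f M - f N`. -/
lemma AntitoneOn.sum_sub_integral_bounds {f : ℝ → ℝ} {a M : ℤ}
    (hf : AntitoneOn f (Set.Ici (a : ℝ))) (haM : a ≤ M) (N : ℤ) (hMN : M ≤ N) :
    (∑ n ∈ Finset.Icc a N, f n) - (∫ x in (a : ℝ)..N, f x) ≤
        (∑ n ∈ Finset.Icc a M, f n) - (∫ x in (a : ℝ)..M, f x) ∧
      (∑ n ∈ Finset.Icc a M, f n) - (∫ x in (a : ℝ)..M, f x) - f M ≤
        (∑ n ∈ Finset.Icc a N, f n) - (∫ x in (a : ℝ)..N, f x) - f N := by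
  induction N, hMN using Int.leInduction with
  | base => exact ⟨le_rfl, le_rfl⟩
  | succ N hMN ih =>
    have haN : (a : ℝ) ≤ N := by exact_mod_cast haM.trans hMN
    have hsum : ∑ n ∈ Finset.Icc a (N + 1), f n = (∑ n ∈ Finset.Icc a N, f n) + f (N + 1) := by
      have : Finset.Icc a (N + 1) = insert (N + 1) (Finset.Icc a N) := by
        ext n
        simp only [Finset.mem_Icc, Finset.mem_insert]
        lia
      rw [this, Finset.sum_insert (by simp), add_comm]
      push_cast
      rfl
    have hint : ∀ x y : ℝ, (a : ℝ) ≤ x → x ≤ y →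
        IntervalIntegrable f MeasureTheory.volume x y := fun x y hx hxy =>
      (hf.mono (by rw [Set.uIcc_of_le hxy]; exact fun t ht => hx.trans ht.1)).intervalIntegrable
    have hsplit := intervalIntegral.integral_add_adjacent_intervals
      (hint a N le_rfl haN) (hint N (N + 1) haN (by linarith))
    have hb := AntitoneOn.intervalIntegral_bounds (x := N) (y := N + 1) (by linarith)
      (hf.mono fun t ht => haN.trans ht.1)
    rw [hsum]
    push_cast
    constructor <;> linarith [ih.1, ih.2, hb.1, hb.2]

theorem euler_maclaurin_error_bound (a : ℤ) (f : ℝ → ℝ)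
    (hf0 : ∀ x : ℝ, (a : ℝ) ≤ x → 0 ≤ f x)
    (hfmono : AntitoneOn f (Set.Ici (a : ℝ)))
    (hflim : Tendsto f atTop (𝓝 0)) (α : ℝ)
    (hα : Tendsto (fun N : ℤ => (∑ n ∈ Finset.Icc a N, f n) - ∫ x in (a : ℝ)..(N : ℝ), f x)
        atTop (𝓝 α)) :
    ∀ ξ : ℝ, (a : ℝ) + 1 ≤ ξ →
      |(∑ n ∈ Finset.Icc a ⌊ξ⌋, f n) - (∫ ν in (a : ℝ)..ξ, f ν) - α| ≤ f (ξ - 1) := by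
  intro ξ hξ
  have haM : a ≤ ⌊ξ⌋ := Int.le_floor.2 (by linarith)
  have haM' : (a : ℝ) ≤ ⌊ξ⌋ := by exact_mod_cast haM
  have hMξ := Int.floor_le ξ
  have hξM := Int.lt_floor_add_one ξ
  have hupper := le_of_tendsto hα ((eventually_ge_atTop ⌊ξ⌋).mono fun N hN =>
    (hfmono.sum_sub_integral_bounds haM N hN).1)
  have hlower : (∑ n ∈ Finset.Icc a ⌊ξ⌋, f n) - (∫ x in (a : ℝ)..⌊ξ⌋, f x) - f ⌊ξ⌋ ≤ α := by
    refine ge_of_tendsto hα ((eventually_ge_atTop ⌊ξ⌋).mono fun N hN => ?_)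
    have hfN := hf0 N (by exact_mod_cast haM.trans hN)
    linarith [(hfmono.sum_sub_integral_bounds haM N hN).2]
  have hint : ∀ x y : ℝ, (a : ℝ) ≤ x → x ≤ y →
      IntervalIntegrable f MeasureTheory.volume x y := fun x y hx hxy =>
    (hfmono.mono (by rw [Set.uIcc_of_le hxy]; exact fun t ht => hx.trans ht.1)).intervalIntegrable
  have hsplit := intervalIntegral.integral_add_adjacent_intervals
    (hint a ⌊ξ⌋ le_rfl haM') (hint ⌊ξ⌋ ξ haM' hMξ)
  have hb := AntitoneOn.intervalIntegral_bounds hMξ (hfmono.mono fun t ht => haM'.trans ht.1)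
  have hpos : 0 ≤ (ξ - ⌊ξ⌋) * f ξ := mul_nonneg (by linarith) (hf0 ξ (by linarith))
  have hle : (ξ - ⌊ξ⌋) * f ⌊ξ⌋ ≤ f ⌊ξ⌋ := mul_le_of_le_one_left (hf0 _ haM') (by linarith)
  have hmono : f ⌊ξ⌋ ≤ f (ξ - 1) :=
    hfmono (Set.mem_Ici.2 (by linarith)) (Set.mem_Ici.2 haM') (by linarith)
  rw [abs_le]
  constructor <;> linarith [hb.1, hb.2]
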